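/- Let 0 < α ≤ 1/2, let f ∈ 𝒜_α be outer with ‖f‖_{𝒜_α} ≤ 1, let 1 < ρ ≤ 2, let Γ be a union of component arcs of 𝕋\E_f, and let γ = (a,b) be a component arc of 𝕋\E_f of arclength < 1/2. Set Δ_γ¹ := {z ∈ Δ_γ : d(z) < 2(1−|z|)}. Then ∫_{Δ_γ¹} |f(z)|^{2ρ} |f_Γ'(z)|² dA(z) ≤ C_ρ · ∫_{Δ_γ} |f'(z)|² dA(z), where C_ρ > 0 depends only on ρ and α. -/

import Mathlib

open Complex MeasureTheory Set Metric Filter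
open scoped ENNReal Classical

noncomputable section

/-- The open unit disc in `ℂ`. -/
def uDisc : Set ℂ := Metric.ball 0 1

/-- The unit circle in `ℂ`. -/
def uCircle : Set ℂ := Metric.sphere (0 : ℂ) 1

/-- `f` is analytic on the open unit disc and continuous on the closed unit disc. -/
def IsDiscReg (f : ℂ → ℂ) : Prop :=
  DifferentiableOn ℂ f uDisc ∧ ContinuousOn f (Metric.closedBall 0 1)

/-- The little-o Lipschitz condition of order `α` on the closed unit disc:
`|f z - f w| = o(|z-w|^α)` as `|z - w| → 0`. -/
def LittleLip (α : ℝ) (f : ℂ → ℂ) : Prop :=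
  ∀ ε > 0, ∃ δ > 0, ∀ z ∈ Metric.closedBall (0 : ℂ) 1, ∀ w ∈ Metric.closedBall (0 : ℂ) 1,
    ‖z - w‖ < δ → ‖f z - f w‖ ≤ ε * ‖z - w‖ ^ α

/-- Membership in `lip_α`. -/
def MemLip (α : ℝ) (f : ℂ → ℂ) : Prop := IsDiscReg f ∧ LittleLip α f

/-- The Dirichlet integral `D(f) = ∫_𝔻 |f'|² dA` with respect to the normalized
area measure `dA = (1/π)·(Lebesgue)`. -/
def dirInt (f : ℂ → ℂ) : ℝ := (1 / Real.pi) * ∫ z in uDisc, ‖deriv f z‖ ^ 2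

/-- Membership in the Dirichlet space `𝒟`. -/
def MemDir (f : ℂ → ℂ) : Prop :=
  DifferentiableOn ℂ f uDisc ∧ IntegrableOn (fun z => ‖deriv f z‖ ^ 2) uDisc

/-- Sup norm over the unit disc. -/
def supNorm (f : ℂ → ℂ) : ℝ := sSup ((fun z => ‖f z‖) '' uDisc)

/-- The `lip_α` norm `‖f‖_α = ‖f‖_∞ + sup_{z∈𝔻} (1-|z|)^{1-α}|f'(z)|`. -/
def lipNorm (α : ℝ) (f : ℂ → ℂ) : ℝ :=
  supNorm f + sSup ((fun z => (1 - ‖z‖) ^ (1 - α) * ‖deriv f z‖) '' uDisc)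

/-- The `𝒜_α` norm `‖f‖_{𝒜_α} = ‖f‖_α + D(f)^{1/2}`. -/
def ANorm (α : ℝ) (f : ℂ → ℂ) : ℝ := lipNorm α f + Real.sqrt (dirInt f)

/-- Membership in `𝒜_α = 𝒟 ∩ lip_α`. -/
def MemA (α : ℝ) (f : ℂ → ℂ) : Prop := MemDir f ∧ MemLip α f

/-- A closed ideal of the Banach algebra `𝒜_α`, encoded as a set of functions `ℂ → ℂ`
(two functions agreeing on the closed disc represent the same element of `𝒜_α`). -/
structure IsClosedIdeal (α : ℝ) (J : Set (ℂ → ℂ)) : Prop where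
  mem_A : ∀ f ∈ J, MemA α f
  zero_mem : (0 : ℂ → ℂ) ∈ J
  add_mem : ∀ f ∈ J, ∀ g ∈ J, f + g ∈ J
  smul_mem : ∀ (c : ℂ), ∀ f ∈ J, c • f ∈ J
  mul_mem : ∀ f ∈ J, ∀ g : ℂ → ℂ, MemA α g → f * g ∈ J
  ext_mem : ∀ f ∈ J, ∀ g : ℂ → ℂ, MemA α g →
    (∀ z ∈ Metric.closedBall (0 : ℂ) 1, g z = f z) → g ∈ J
  closed : ∀ (F : ℕ → ℂ → ℂ) (f : ℂ → ℂ), (∀ n, F n ∈ J) → MemA α f →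
    Tendsto (fun n => ANorm α (F n - f)) atTop (nhds 0) → f ∈ J

/-- The boundary zero set `E_f = {ξ ∈ 𝕋 : f ξ = 0}`. -/
def bZeros (f : ℂ → ℂ) : Set ℂ := {ξ | ξ ∈ uCircle ∧ f ξ = 0}

/-- An inner function: bounded analytic on `𝔻` with radial limits of modulus `1`
at almost every point of `𝕋`. -/
def IsInner (U : ℂ → ℂ) : Prop :=
  DifferentiableOn ℂ U uDisc ∧ (∀ z ∈ uDisc, ‖U z‖ ≤ 1) ∧
    ∀ᵐ θ : ℝ, Tendsto (fun r : ℝ => ‖U ((r : ℂ) * Complex.exp ((θ : ℂ) * Complex.I))‖)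
      (nhdsWithin 1 (Set.Iio 1)) (nhds 1)

/-- The Schwarz/Herglotz kernel `(e^{iθ}+z)/(e^{iθ}-z)`. -/
def circleKernel (z : ℂ) (θ : ℝ) : ℂ :=
  (Complex.exp ((θ : ℂ) * Complex.I) + z) / (Complex.exp ((θ : ℂ) * Complex.I) - z)

/-- `f` is an outer function. -/
def IsOuter (f : ℂ → ℂ) : Prop :=
  IsDiscReg f ∧ (∃ z ∈ uDisc, f z ≠ 0) ∧
    ∀ z ∈ uDisc, f z = Complex.exp ((1 / (2 * (Real.pi : ℂ))) *
      ∫ θ in (0:ℝ)..(2 * Real.pi),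
        circleKernel z θ * (Real.log ‖f (Complex.exp ((θ : ℂ) * Complex.I))‖ : ℂ))

/-- The outer power `f^ρ`, the outer function with boundary modulus `|f|^ρ`. -/
def outerPow (f : ℂ → ℂ) (ρ : ℝ) (z : ℂ) : ℂ :=
  Complex.exp (((ρ : ℂ) / (2 * (Real.pi : ℂ))) *
    ∫ θ in (0:ℝ)..(2 * Real.pi),
      circleKernel z θ * (Real.log ‖f (Complex.exp ((θ : ℂ) * Complex.I))‖ : ℂ))

/-- The set of angles in `[0, 2π)` whose corresponding point of the circle lies in `A`. -/
def angSet (A : Set ℂ) : Set ℝ :=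
  {θ | θ ∈ Set.Ico (0 : ℝ) (2 * Real.pi) ∧ Complex.exp ((θ : ℂ) * Complex.I) ∈ A}

/-- The outer factor `f_Γ` associated with a boundary set `Γ ⊆ 𝕋`. -/
def outerPart (f : ℂ → ℂ) (Γ : Set ℂ) (z : ℂ) : ℂ :=
  Complex.exp ((1 / (2 * (Real.pi : ℂ))) *
    ∫ θ in angSet Γ, circleKernel z θ * (Real.log ‖f (Complex.exp ((θ : ℂ) * Complex.I))‖ : ℂ))

/-- `𝕋 \ E_f`, the set of boundary points where `f` does not vanish. -/
def offZeros (f : ℂ → ℂ) : Set ℂ := {ξ | ξ ∈ uCircle ∧ f ξ ≠ 0}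

/-- `γ` is a component arc (connected component) of `𝕋 \ E_f`. -/
def IsCompArc (f : ℂ → ℂ) (γ : Set ℂ) : Prop :=
  ∃ x ∈ offZeros f, γ = connectedComponentIn (offZeros f) x

/-- `Γ` is a union of component arcs of `𝕋 \ E_f`. -/
def IsArcUnion (f : ℂ → ℂ) (Γ : Set ℂ) : Prop :=
  Γ ⊆ offZeros f ∧ ∀ x ∈ Γ, connectedComponentIn (offZeros f) x ⊆ Γ

/-- The sector `Δ_γ = {z ∈ 𝔻 : z/|z| ∈ γ}`. -/
def discSector (γ : Set ℂ) : Set ℂ := {z | z ∈ uDisc ∧ ((‖z‖ : ℂ))⁻¹ * z ∈ γ}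

/-- Lower integral of `g` over `S` with respect to the normalized area measure
`dA = (1/π)·(Lebesgue)`. -/
def nlint (S : Set ℂ) (g : ℂ → ℝ) : ℝ≥0∞ :=
  ENNReal.ofReal (1 / Real.pi) * ∫⁻ z in S, ENNReal.ofReal (g z)

/-- `d(z) = min(|z-a|, |z-b|)`, distance to the endpoints of the arc `γ = (a,b)`. -/
def dd (a b z : ℂ) : ℝ := min ‖z - a‖ ‖z - b‖

/-- `Λ_γ`: equals `Γ` if `γ ⊄ Γ`, and `𝕋 \ Γ` if `γ ⊆ Γ`. -/
def lamSet (Γ γ : Set ℂ) : Set ℂ := if γ ⊆ Γ then uCircle \ Γ else Γ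

/-- The function `a_γ(z) = (1/2π)∫_{Λ_γ} (−log|f(e^{iθ})|)/|e^{iθ}−z|² dθ`. -/
def aFun (f : ℂ → ℂ) (Γ γ : Set ℂ) (z : ℂ) : ℝ :=
  (1 / (2 * Real.pi)) * ∫ θ in angSet (lamSet Γ γ),
    (-(Real.log ‖f (Complex.exp ((θ : ℂ) * Complex.I))‖)) /
      ‖Complex.exp ((θ : ℂ) * Complex.I) - z‖ ^ 2

/-- `Δ_γ¹ = {z ∈ Δ_γ : d(z) < 2(1−|z|)}`. -/
def sector1 (a b : ℂ) (γ : Set ℂ) : Set ℂ :=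
  {z | z ∈ discSector γ ∧ dd a b z < 2 * (1 - ‖z‖)}

/-- `Δ_γ² = {z ∈ Δ_γ : d(z) ≥ 2(1−|z|)}`. -/
def sector2 (a b : ℂ) (γ : Set ℂ) : Set ℂ :=
  {z | z ∈ discSector γ ∧ 2 * (1 - ‖z‖) ≤ dd a b z}

/-- `Δ_γ²¹ = {z ∈ Δ_γ² : a_γ(z) ≤ 8|log d(z)|/d(z)}`. -/
def sector21 (f : ℂ → ℂ) (Γ γ : Set ℂ) (a b : ℂ) : Set ℂ :=
  {z | z ∈ sector2 a b γ ∧ aFun f Γ γ z ≤ 8 * |Real.log (dd a b z)| / dd a b z}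

/-- `Δ_γ²² = {z ∈ Δ_γ² : 8|log d(z)|/d(z) < a_γ(z) < 8|log d(z)|/(1−|z|)}`. -/
def sector22 (f : ℂ → ℂ) (Γ γ : Set ℂ) (a b : ℂ) : Set ℂ :=
  {z | z ∈ sector2 a b γ ∧ 8 * |Real.log (dd a b z)| / dd a b z < aFun f Γ γ z ∧
    aFun f Γ γ z < 8 * |Real.log (dd a b z)| / (1 - ‖z‖)}

/-- `Δ_γ²³ = {z ∈ Δ_γ² : a_γ(z) ≥ 8|log d(z)|/(1−|z|)}`. -/
def sector23 (f : ℂ → ℂ) (Γ γ : Set ℂ) (a b : ℂ) : Set ℂ :=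
  {z | z ∈ sector2 a b γ ∧ 8 * |Real.log (dd a b z)| / (1 - ‖z‖) ≤ aFun f Γ γ z}

/-- `μ_z = 1 − 8|log d(z)|/a_γ(z)`. -/
def muOf (f : ℂ → ℂ) (Γ γ : Set ℂ) (a b : ℂ) (z : ℂ) : ℝ :=
  1 - 8 * |Real.log (dd a b z)| / aFun f Γ γ z

/-- The tail union `Γ_m = ⋃_{p ≥ m} γ_p`. -/
def tailUnion (γ : ℕ → Set ℂ) (m : ℕ) : Set ℂ := ⋃ p ∈ Set.Ici m, γ p

end

lemma uDisc_norm_lt {z : ℂ} (hz : z ∈ uDisc) : ‖z‖ < 1 := by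
  simpa [uDisc] using hz

lemma one_sub_norm_le_norm_exp_sub (z : ℂ) (θ : ℝ) :
    1 - ‖z‖ ≤ ‖Complex.exp ((θ : ℂ) * Complex.I) - z‖ := by
  have := norm_sub_norm_le (Complex.exp ((θ : ℂ) * Complex.I)) z
  rwa [Complex.norm_exp_ofReal_mul_I] at this

lemma exp_sub_ne_zero {z : ℂ} (hz : z ∈ uDisc) (θ : ℝ) :
    Complex.exp ((θ : ℂ) * Complex.I) - z ≠ 0 := by
  have h := one_sub_norm_le_norm_exp_sub z θ
  have := uDisc_norm_lt hz
  exact norm_pos_iff.1 (by linarith)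

lemma continuous_circleKernel {z : ℂ} (hz : z ∈ uDisc) : Continuous (circleKernel z) := by
  unfold circleKernel
  exact Continuous.div (by fun_prop) (by fun_prop) (exp_sub_ne_zero hz)

lemma hasDerivAt_circleKernel {z : ℂ} (hz : z ∈ uDisc) (θ : ℝ) :
    HasDerivAt (fun w => circleKernel w θ)
      (2 * Complex.exp ((θ : ℂ) * Complex.I) / (Complex.exp ((θ : ℂ) * Complex.I) - z) ^ 2) z := by
  unfold circleKernel
  have h := ((hasDerivAt_id z).const_add (Complex.exp ((θ : ℂ) * Complex.I))).div
    ((hasDerivAt_id z).const_sub (Complex.exp ((θ : ℂ) * Complex.I))) (exp_sub_ne_zero hz θ)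
  refine h.congr_deriv ?_
  simp only [id]
  ring

lemma norm_circleKernel_le {z : ℂ} (hz : z ∈ uDisc) (θ : ℝ) :
    ‖circleKernel z θ‖ ≤ 2 / (1 - ‖z‖) := by
  have h1 := uDisc_norm_lt hz
  unfold circleKernel
  rw [norm_div]
  refine div_le_div₀ (by norm_num) ?_ (by linarith) (one_sub_norm_le_norm_exp_sub z θ)
  refine (norm_add_le _ _).trans ?_
  rw [Complex.norm_exp_ofReal_mul_I]
  linarith

lemma re_circleKernel {z : ℂ} (θ : ℝ) :
    (circleKernel z θ).re =
      (1 - ‖z‖ ^ 2) / ‖Complex.exp ((θ : ℂ) * Complex.I) - z‖ ^ 2 := by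
  unfold circleKernel
  have h : ‖Complex.exp ((θ : ℂ) * Complex.I)‖ ^ 2 = 1 := by
    rw [Complex.norm_exp_ofReal_mul_I]; norm_num
  set e := Complex.exp ((θ : ℂ) * Complex.I)
  rw [Complex.div_re, ← add_div, ← Complex.normSq_eq_norm_sq (e - z), ← h,
    ← Complex.normSq_eq_norm_sq, ← Complex.normSq_eq_norm_sq, Complex.normSq_apply e,
    Complex.normSq_apply z]
  congr 1
  simp
  ring

lemma integrable_circleKernel_mul {μ : Measure ℝ} {l : ℝ → ℝ} (hl : Integrable l μ) {z : ℂ}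
    (hz : z ∈ uDisc) : Integrable (fun θ => circleKernel z θ * (l θ : ℂ)) μ :=
  hl.ofReal.bdd_mul (continuous_circleKernel hz).aestronglyMeasurable
    (Eventually.of_forall (norm_circleKernel_le hz))

lemma hasDerivAt_integral_circleKernel {μ : Measure ℝ} {l : ℝ → ℝ} (hl : Integrable l μ) {z : ℂ}
    (hz : z ∈ uDisc) :
    HasDerivAt (fun w => ∫ θ, circleKernel w θ * (l θ : ℂ) ∂μ)
      (∫ θ, 2 * Complex.exp ((θ : ℂ) * Complex.I) /
        (Complex.exp ((θ : ℂ) * Complex.I) - z) ^ 2 * (l θ : ℂ) ∂μ) z := by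
  have h1 := uDisc_norm_lt hz
  set r := (1 - ‖z‖) / 2 with hr
  have hr0 : 0 < r := by rw [hr]; linarith
  have hball : ∀ w ∈ ball z r, ‖w‖ < 1 - r := by
    intro w hw
    have h2 : ‖w - z‖ < r := by simpa [dist_eq_norm] using hw
    have h3 := norm_le_norm_add_norm_sub' w z
    rw [hr] at h2 ⊢
    linarith
  have hmem : ∀ w ∈ ball z r, w ∈ uDisc := by
    intro w hw
    have := hball w hw
    simp only [uDisc, mem_ball_zero_iff]
    linarith
  refine (hasDerivAt_integral_of_dominated_loc_of_deriv_le (s := ball z r)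
    (bound := fun θ => 2 / r ^ 2 * |l θ|)
    (F' := fun w θ => 2 * Complex.exp ((θ : ℂ) * Complex.I) /
        (Complex.exp ((θ : ℂ) * Complex.I) - w) ^ 2 * (l θ : ℂ))
    (ball_mem_nhds z hr0) ?_ (integrable_circleKernel_mul hl hz) ?_ ?_
    (hl.abs.const_mul _) ?_).2
  · filter_upwards [ball_mem_nhds z hr0] with w hw
    exact (integrable_circleKernel_mul hl (hmem w hw)).aestronglyMeasurable
  · refine (Continuous.aestronglyMeasurable ?_).mul hl.ofReal.aestronglyMeasurable
    exact Continuous.div (by fun_prop) (by fun_prop) fun θ => pow_ne_zero _ (exp_sub_ne_zero hz θ)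
  · refine Eventually.of_forall fun θ w hw => ?_
    have h4 := one_sub_norm_le_norm_exp_sub w θ
    have h5 := hball w hw
    rw [norm_mul, norm_div, norm_mul, norm_pow, Complex.norm_exp_ofReal_mul_I, Complex.norm_real]
    simp only [Complex.norm_ofNat, mul_one, Real.norm_eq_abs]
    gcongr
    linarith
  · exact Eventually.of_forall fun θ w hw => (hasDerivAt_circleKernel (hmem w hw) θ).mul_const _

lemma angSet_subset (A : Set ℂ) : angSet A ⊆ Icc 0 (2 * Real.pi) :=
  fun _ hθ => ⟨hθ.1.1, hθ.1.2.le⟩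

lemma log_norm_outer {f : ℂ → ℂ} (hf : IsOuter f)
    (hl : IntegrableOn (fun θ : ℝ => Real.log ‖f (Complex.exp ((θ : ℂ) * Complex.I))‖)
      (Icc 0 (2 * Real.pi))) {z : ℂ} (hz : z ∈ uDisc) :
    Real.log ‖f z‖ = 1 / (2 * Real.pi) * ∫ θ in Icc 0 (2 * Real.pi), (1 - ‖z‖ ^ 2) /
      ‖Complex.exp ((θ : ℂ) * Complex.I) - z‖ ^ 2 *
        Real.log ‖f (Complex.exp ((θ : ℂ) * Complex.I))‖ := by
  rw [hf.2.2 z hz, Complex.norm_exp, Real.log_exp,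
    intervalIntegral.integral_of_le (by positivity), ← integral_Icc_eq_integral_Ioc]
  have h1 : (1 / (2 * (Real.pi : ℂ))) = ((1 / (2 * Real.pi) : ℝ) : ℂ) := by push_cast; rfl
  rw [h1, Complex.re_ofReal_mul]
  congr 1
  have h2 := integral_re (𝕜 := ℂ) (integrable_circleKernel_mul hl hz)
  simp only [RCLike.re_to_complex] at h2
  rw [← h2]
  refine integral_congr_ae (Eventually.of_forall fun θ => ?_)
  simp only [Complex.re_mul_ofReal, re_circleKernel]

/-- The derivative of the outer factor `f_Γ` is controlled by `log (1 / |f|)`. -/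
lemma norm_deriv_outerPart_le {f : ℂ → ℂ} (hf : IsOuter f)
    (hl : IntegrableOn (fun θ : ℝ => Real.log ‖f (Complex.exp ((θ : ℂ) * Complex.I))‖)
      (Icc 0 (2 * Real.pi)))
    (hf1 : ∀ θ : ℝ, ‖f (Complex.exp ((θ : ℂ) * Complex.I))‖ ≤ 1) (Γ : Set ℂ) {z : ℂ}
    (hz : z ∈ uDisc) :
    ‖deriv (outerPart f Γ) z‖ ≤ 2 * (-Real.log ‖f z‖) / (1 - ‖z‖) := by
  have hz1 := uDisc_norm_lt hz
  set l := fun θ : ℝ => Real.log ‖f (Complex.exp ((θ : ℂ) * Complex.I))‖ with hldef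
  have hl0 : ∀ θ, l θ ≤ 0 := fun θ => Real.log_nonpos (norm_nonneg _) (hf1 θ)
  have hle : volume.restrict (angSet Γ) ≤ volume.restrict (Icc 0 (2 * Real.pi)) :=
    Measure.restrict_mono_set _ (angSet_subset Γ)
  have hlΓ : Integrable l (volume.restrict (angSet Γ)) :=
    Integrable.mono_measure hl hle
  have hd := ((hasDerivAt_integral_circleKernel hlΓ hz).const_mul
    (1 / (2 * (Real.pi : ℂ)))).cexp
  have hd' : deriv (outerPart f Γ) z = _ := hd.deriv
  have hc : (1 / (2 * (Real.pi : ℂ))) = ((1 / (2 * Real.pi) : ℝ) : ℂ) := by push_cast; rfl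
  have hexp : ‖Complex.exp ((1 / (2 * (Real.pi : ℂ))) *
      ∫ θ in angSet Γ, circleKernel z θ * (l θ : ℂ))‖ ≤ 1 := by
    rw [Complex.norm_exp, Real.exp_le_one_iff, hc, Complex.re_ofReal_mul]
    refine mul_nonpos_of_nonneg_of_nonpos (by positivity) ?_
    have h2 := integral_re (𝕜 := ℂ) (integrable_circleKernel_mul hlΓ hz)
    simp only [RCLike.re_to_complex] at h2
    rw [← h2]
    refine integral_nonpos fun θ => ?_
    simp only [Complex.re_mul_ofReal, re_circleKernel]
    refine mul_nonpos_of_nonneg_of_nonpos (div_nonneg ?_ (by positivity)) (hl0 θ)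
    nlinarith [norm_nonneg z]
  set k := fun θ : ℝ => 1 / ‖Complex.exp ((θ : ℂ) * Complex.I) - z‖ ^ 2 * (-l θ) with hk
  have hk0 : ∀ θ, 0 ≤ k θ := fun θ => mul_nonneg (by positivity) (by linarith [hl0 θ])
  have hkint : IntegrableOn k (Icc 0 (2 * Real.pi)) := by
    refine Integrable.bdd_mul (c := 1 / (1 - ‖z‖) ^ 2) hl.neg
      (Continuous.aestronglyMeasurable ?_) (Eventually.of_forall fun θ => ?_)
    · exact Continuous.div (by fun_prop) (by fun_prop)
        fun θ => pow_ne_zero _ (norm_ne_zero_iff.2 (exp_sub_ne_zero hz θ))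
    · rw [Real.norm_of_nonneg (by positivity)]
      have := one_sub_norm_le_norm_exp_sub z θ
      have : 0 < 1 - ‖z‖ := by linarith
      gcongr
  have hI : ‖∫ θ in angSet Γ, 2 * Complex.exp ((θ : ℂ) * Complex.I) /
      (Complex.exp ((θ : ℂ) * Complex.I) - z) ^ 2 * (l θ : ℂ)‖ ≤
      2 * ∫ θ in Icc 0 (2 * Real.pi), k θ := by
    refine (norm_integral_le_integral_norm _).trans ?_
    rw [← integral_const_mul]
    have heq : ∀ θ : ℝ, ‖2 * Complex.exp ((θ : ℂ) * Complex.I) /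
      (Complex.exp ((θ : ℂ) * Complex.I) - z) ^ 2 * (l θ : ℂ)‖ = 2 * k θ := by
      intro θ
      rw [norm_mul, norm_div, norm_mul, norm_pow, Complex.norm_exp_ofReal_mul_I, Complex.norm_real,
        Real.norm_of_nonpos (hl0 θ), hk]
      simp only [Complex.norm_ofNat, mul_one]
      ring
    simp_rw [heq]
    exact integral_mono_measure hle (Eventually.of_forall fun θ => by
      have := hk0 θ
      simp only [Pi.zero_apply]
      linarith) (hkint.const_mul 2)
  have hlog := log_norm_outer hf hl hz
  have hlog' : -Real.log ‖f z‖ = 1 / (2 * Real.pi) * (1 - ‖z‖ ^ 2) *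
      ∫ θ in Icc 0 (2 * Real.pi), k θ := by
    rw [hlog, ← mul_neg, ← integral_neg, mul_assoc,
      ← integral_const_mul (1 - ‖z‖ ^ 2)]
    congr 1
    refine integral_congr_ae (Eventually.of_forall fun θ => ?_)
    simp only [hk, hldef]
    ring
  have hK0 : 0 ≤ ∫ θ in Icc 0 (2 * Real.pi), k θ := integral_nonneg hk0
  set K := ∫ θ in Icc 0 (2 * Real.pi), k θ
  rw [hd', norm_mul, norm_mul, hc, Complex.norm_real, Real.norm_of_nonneg (by positivity), ← hc]
  have hpi := Real.pi_pos
  calc _ ≤ 1 * (1 / (2 * Real.pi) * (2 * K)) := by gcongr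
    _ ≤ _ := by
      rw [hlog', le_div_iff₀ (by linarith)]
      have : 0 ≤ 1 / (2 * Real.pi) * K := by positivity
      have : 0 ≤ (1 / (2 * Real.pi) * K) * (2 * ‖z‖ * (1 - ‖z‖)) := by
        have := norm_nonneg z
        have : 0 ≤ 1 - ‖z‖ := by linarith
        positivity
      nlinarith

lemma bddAbove_weighted_deriv {α : ℝ} {f : ℂ → ℂ} (hf : MemLip α f) :
    BddAbove ((fun z => (1 - ‖z‖) ^ (1 - α) * ‖deriv f z‖) '' uDisc) := by
  obtain ⟨δ, hδ, h⟩ := hf.2 1 one_pos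
  set c := min δ 1 / 2 with hc
  have hm : 0 < min δ 1 := lt_min hδ one_pos
  have hc0 : 0 < c := by positivity
  have hcδ : c < δ := by
    have := min_le_left δ 1
    rw [hc]; linarith
  have hc1 : c ≤ 1 / 2 := by
    have := min_le_right δ 1
    rw [hc]; linarith
  refine ⟨c ^ (α - 1), ?_⟩
  rintro _ ⟨z, hz, rfl⟩
  have hz1 := uDisc_norm_lt hz
  have hz0 : 0 < 1 - ‖z‖ := by linarith
  set r := c * (1 - ‖z‖) with hr
  have hr0 : 0 < r := mul_pos hc0 hz0
  have hrz : r ≤ (1 - ‖z‖) / 2 := by rw [hr]; nlinarith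
  have hrδ : r < δ := by rw [hr]; nlinarith [norm_nonneg z]
  have hsub : closedBall z r ⊆ uDisc := by
    intro w hw
    have h2 : ‖w - z‖ ≤ r := by simpa [dist_eq_norm] using hw
    have h3 := norm_le_norm_add_norm_sub' w z
    simp only [uDisc, mem_ball_zero_iff]
    linarith
  have hdiff : DiffContOnCl ℂ (fun w => f w - f z) (ball z r) := by
    refine DifferentiableOn.diffContOnCl ?_
    rw [closure_ball z hr0.ne']
    exact (hf.1.1.mono hsub).sub_const _
  have hd := Complex.norm_deriv_le_of_forall_mem_sphere_norm_le (C := r ^ α) hr0 hdiff (by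
    intro w hw
    have hwz : ‖w - z‖ = r := by simpa [dist_eq_norm] using hw
    have := h w (ball_subset_closedBall (hsub (sphere_subset_closedBall hw))) z
      (ball_subset_closedBall hz) (by rw [hwz]; exact hrδ)
    rwa [hwz, one_mul] at this)
  rw [deriv_sub_const] at hd
  calc (1 - ‖z‖) ^ (1 - α) * ‖deriv f z‖ ≤ (1 - ‖z‖) ^ (1 - α) * (r ^ α / r) := by gcongr
    _ = c ^ (α - 1) := by
      rw [← Real.rpow_sub_one hr0.ne', hr, Real.mul_rpow hc0.le hz0.le, mul_left_comm,
        ← Real.rpow_add hz0]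
      simp

lemma bddAbove_norm {f : ℂ → ℂ} (hf : IsDiscReg f) :
    BddAbove ((fun z => ‖f z‖) '' uDisc) := by
  refine BddAbove.mono (image_mono ball_subset_closedBall)
    ((isCompact_closedBall (0 : ℂ) 1).bddAbove_image hf.2.norm)

lemma zero_mem_uDisc : (0 : ℂ) ∈ uDisc := by simp [uDisc]

lemma norm_deriv_le_of_ANorm_le {α : ℝ} {f : ℂ → ℂ} (hf : MemLip α f)
    (hn : ANorm α f ≤ 1) {z : ℂ} (hz : z ∈ uDisc) : ‖deriv f z‖ ≤ (1 - ‖z‖) ^ (α - 1) := by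
  have hz0 : 0 < 1 - ‖z‖ := by linarith [uDisc_norm_lt hz]
  have h1 := le_csSup (bddAbove_weighted_deriv hf) (mem_image_of_mem _ hz)
  have h2 : 0 ≤ supNorm f := (norm_nonneg _).trans
    (le_csSup (bddAbove_norm hf.1) (mem_image_of_mem _ zero_mem_uDisc))
  have h3 := Real.sqrt_nonneg (dirInt f)
  unfold ANorm lipNorm at hn
  have h4 : (1 - ‖z‖) ^ (1 - α) * ‖deriv f z‖ ≤ 1 := by linarith
  have h5 : (1 - ‖z‖) ^ (α - 1) = ((1 - ‖z‖) ^ (1 - α))⁻¹ := by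
    rw [← Real.rpow_neg hz0.le]; ring_nf
  rw [h5, ← one_div, le_div_iff₀' (Real.rpow_pos_of_pos hz0 _)]
  exact h4

lemma norm_le_one_of_ANorm_le {α : ℝ} {f : ℂ → ℂ} (hf : MemLip α f)
    (hn : ANorm α f ≤ 1) {z : ℂ} (hz : z ∈ closedBall (0 : ℂ) 1) : ‖f z‖ ≤ 1 := by
  have hdisc : ∀ w ∈ uDisc, ‖f w‖ ≤ 1 := by
    intro w hw
    have h1 := le_csSup (bddAbove_norm hf.1) (mem_image_of_mem _ hw)
    have h2 : 0 ≤ sSup ((fun z => (1 - ‖z‖) ^ (1 - α) * ‖deriv f z‖) '' uDisc) :=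
      (mul_nonneg (Real.rpow_nonneg (by simp) _) (norm_nonneg _)).trans
        (le_csSup (bddAbove_weighted_deriv hf) (mem_image_of_mem _ zero_mem_uDisc))
    have h3 := Real.sqrt_nonneg (dirInt f)
    unfold ANorm lipNorm supNorm at hn
    linarith
  have hcl : closure uDisc = closedBall (0 : ℂ) 1 := closure_ball 0 one_ne_zero
  exact le_on_closure hdisc (hcl ▸ hf.1.2.norm) continuousOn_const (hcl ▸ hz)

lemma integrableOn_log_of_outer {f : ℂ → ℂ} (hf : IsOuter f) {a : ℂ} (ha : a ∈ bZeros f) :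
    IntegrableOn (fun θ : ℝ => Real.log ‖f (Complex.exp ((θ : ℂ) * Complex.I))‖)
      (Icc 0 (2 * Real.pi)) := by
  by_contra hl
  have h1 : ∀ z ∈ uDisc, f z = 1 := by
    intro z hz
    rw [hf.2.2 z hz, intervalIntegral.integral_of_le (by positivity),
      ← integral_Icc_eq_integral_Ioc, integral_undef, mul_zero, Complex.exp_zero]
    intro hint
    apply hl
    have hz1 := uDisc_norm_lt hz
    have hne : ∀ θ : ℝ, Complex.exp ((θ : ℂ) * Complex.I) + z ≠ 0 := by
      intro θ
      have := exp_sub_ne_zero (z := -z) (by simpa [uDisc] using hz) θ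
      rwa [sub_neg_eq_add] at this
    have hk : ∀ θ, circleKernel z θ ≠ 0 := fun θ => div_ne_zero (hne θ) (exp_sub_ne_zero hz θ)
    have h2 : IntegrableOn (fun θ : ℝ => (circleKernel z θ)⁻¹ * (circleKernel z θ *
        (Real.log ‖f (Complex.exp ((θ : ℂ) * Complex.I))‖ : ℂ))) (Icc 0 (2 * Real.pi)) :=
      IntegrableOn.continuousOn_mul ((continuous_circleKernel hz).inv₀ hk).continuousOn hint
        isCompact_Icc
    have h3 := h2.re
    refine h3.congr (Eventually.of_forall fun θ => ?_)
    simp [inv_mul_cancel_left₀ (hk θ)]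
  have hcl : closure uDisc = closedBall (0 : ℂ) 1 := closure_ball 0 one_ne_zero
  have h2 : f a = 1 := by
    have h3 : ∀ w ∈ uDisc, ‖f w - 1‖ ≤ 0 := fun w hw => by simp [h1 w hw]
    have h4 : ‖f a - 1‖ ≤ 0 := le_on_closure h3
      (hcl ▸ (hf.1.2.sub continuousOn_const).norm) continuousOn_const
      (hcl ▸ sphere_subset_closedBall ha.1)
    exact sub_eq_zero.1 (norm_le_zero_iff.1 h4)
  rw [ha.2] at h2
  exact zero_ne_one h2

lemma norm_segment_le {a z : ℂ} (ha : ‖a‖ = 1) {t : ℝ} (ht : t ∈ Icc (0 : ℝ) 1) :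
    t * (1 - ‖z‖) ≤ 1 - ‖a + t * (z - a)‖ := by
  have h1 : a + t * (z - a) = ((1 - t : ℝ) : ℂ) * a + (t : ℂ) * z := by push_cast; ring
  have h2 : ‖a + t * (z - a)‖ ≤ (1 - t) * 1 + t * ‖z‖ := by
    rw [h1]
    refine (norm_add_le _ _).trans_eq ?_
    rw [norm_mul, norm_mul, Complex.norm_real, Complex.norm_real, ha,
      Real.norm_of_nonneg (by linarith [ht.2]), Real.norm_of_nonneg ht.1]
  linarith

/-- A function vanishing at a boundary point `a` is controlled, in a nontangential region
at `a`, by its derivative along the segment to `a`. -/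
lemma enorm_le_lintegral_segment {α : ℝ} (hα0 : 0 < α) (hα1 : α ≤ 1) {f : ℂ → ℂ}
    (hf : IsDiscReg f) (hd : ∀ z ∈ uDisc, ‖deriv f z‖ ≤ (1 - ‖z‖) ^ (α - 1)) {a z : ℂ}
    (ha : a ∈ bZeros f) (hz : z ∈ uDisc) :
    ‖f z‖ₑ ≤ ∫⁻ t in Ioo (0 : ℝ) 1, ‖z - a‖ₑ * ‖deriv f (a + t * (z - a))‖ₑ := by
  have hna : ‖a‖ = 1 := by simpa [bZeros, uCircle] using ha.1
  have hz0 : 0 < 1 - ‖z‖ := by linarith [uDisc_norm_lt hz]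
  have hseg : ∀ t ∈ Ioo (0 : ℝ) 1, a + t * (z - a) ∈ uDisc := by
    intro t ht
    have := norm_segment_le (z := z) hna (Ioo_subset_Icc_self ht)
    simp only [uDisc, mem_ball_zero_iff]
    nlinarith [ht.1]
  have hcont : ContinuousOn (fun t : ℝ => f (a + t * (z - a))) (Icc 0 1) := by
    refine hf.2.comp (by fun_prop) fun t ht => ?_
    have := norm_segment_le (z := z) hna ht
    simp only [mem_closedBall_zero_iff]
    nlinarith [ht.1]
  have hderiv : ∀ t ∈ Ioo (0 : ℝ) 1, HasDerivAt (fun t : ℝ => f (a + t * (z - a)))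
      (deriv f (a + t * (z - a)) * (z - a)) t := by
    intro t ht
    have h1 : HasDerivAt f (deriv f (a + t * (z - a))) (a + t * (z - a)) :=
      ((hf.1 _ (hseg t ht)).differentiableAt (isOpen_ball.mem_nhds (hseg t ht))).hasDerivAt
    have h2 : HasDerivAt (fun t : ℝ => a + (t : ℂ) * (z - a)) (z - a) t := by
      simpa using ((Complex.ofRealCLM.hasDerivAt (x := t)).mul_const (z - a)).const_add a
    exact h1.comp_of_eq t h2 rfl
  have hint : IntervalIntegrable (fun t : ℝ => deriv f (a + t * (z - a)) * (z - a))
      volume 0 1 := by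
    have h1 : IntervalIntegrable (fun t : ℝ => (1 - ‖z‖) ^ (α - 1) * t ^ (α - 1) * ‖z - a‖)
        volume 0 1 :=
      ((intervalIntegral.intervalIntegrable_rpow' (by linarith)).const_mul _).mul_const _
    rw [intervalIntegrable_iff_integrableOn_Ioo_of_le zero_le_one] at h1 ⊢
    refine Integrable.mono' h1 ?_ ?_
    · exact (((measurable_deriv f).comp (by fun_prop)).mul_const _).aestronglyMeasurable
    · filter_upwards [ae_restrict_mem measurableSet_Ioo] with t ht
      rw [norm_mul]
      gcongr
      refine (hd _ (hseg t ht)).trans ?_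
      rw [← Real.mul_rpow hz0.le ht.1.le, mul_comm (1 - ‖z‖) t]
      exact Real.rpow_le_rpow_of_nonpos (mul_pos ht.1 hz0)
        (norm_segment_le hna (Ioo_subset_Icc_self ht)) (by linarith)
  have hftc := intervalIntegral.integral_eq_sub_of_hasDerivAt_of_le zero_le_one hcont hderiv hint
  have hval : f z = ∫ t in (0 : ℝ)..1, deriv f (a + t * (z - a)) * (z - a) := by
    rw [hftc]
    simp [ha.2]
  rw [hval, intervalIntegral.integral_of_le zero_le_one, integral_Ioc_eq_integral_Ioo]
  refine (enorm_integral_le_lintegral_enorm _).trans_eq ?_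
  simp_rw [enorm_mul, mul_comm]

lemma exists_mem_angSet {A : Set ℂ} (hA : A ⊆ uCircle) {ξ : ℂ} (hξ : ξ ∈ A) :
    ∃ θ ∈ angSet A, Complex.exp ((θ : ℂ) * Complex.I) = ξ := by
  have h1 : ‖ξ‖ = 1 := by simpa [uCircle] using hA hξ
  have h2 : Complex.exp ((Complex.arg ξ : ℂ) * Complex.I) = ξ := by
    have := Complex.norm_mul_exp_arg_mul_I ξ
    rwa [h1, Complex.ofReal_one, one_mul] at this
  have hpi := Real.pi_pos
  rcases le_or_gt 0 (Complex.arg ξ) with h | h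
  · exact ⟨Complex.arg ξ, ⟨⟨h, by linarith [Complex.arg_le_pi ξ]⟩, h2.symm ▸ hξ⟩, h2⟩
  · have h3 : Complex.exp (((Complex.arg ξ + 2 * Real.pi : ℝ) : ℂ) * Complex.I) = ξ := by
      push_cast
      rw [add_mul, Complex.exp_add, Complex.exp_two_pi_mul_I, mul_one, h2]
    exact ⟨_, ⟨⟨by linarith [Complex.neg_pi_lt_arg ξ], by linarith⟩, h3.symm ▸ hξ⟩, h3⟩

lemma norm_exp_sub_exp_le (x y : ℝ) :
    ‖Complex.exp ((x : ℂ) * Complex.I) - Complex.exp ((y : ℂ) * Complex.I)‖ ≤ |x - y| := by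
  have h1 : Complex.exp ((x : ℂ) * Complex.I) - Complex.exp ((y : ℂ) * Complex.I) =
      Complex.exp ((y : ℂ) * Complex.I) *
        (Complex.exp (Complex.I * ((x - y : ℝ) : ℂ)) - 1) := by
    rw [mul_sub, ← Complex.exp_add, mul_one]
    congr 2
    push_cast
    ring
  rw [h1, norm_mul, Complex.norm_exp_ofReal_mul_I, one_mul]
  exact Real.norm_exp_I_mul_ofReal_sub_one_le

/-- The diameter of a connected subset of the circle is at most its arclength. -/
lemma ofReal_norm_sub_le_volume_angSet {γ : Set ℂ} (hγ : γ ⊆ uCircle) (hc : IsPreconnected γ)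
    {a ξ : ℂ} (ha : a ∈ closure γ) (hξ : ξ ∈ γ) :
    ENNReal.ofReal ‖ξ - a‖ ≤ volume (angSet γ) := by
  set g : ℝ → ℝ := fun θ => ‖Complex.exp ((θ : ℂ) * Complex.I) - a‖ with hg
  have hlip : LipschitzWith 1 g := by
    refine LipschitzWith.of_dist_le_mul fun x y => ?_
    rw [NNReal.coe_one, one_mul, Real.dist_eq, Real.dist_eq]
    refine (abs_norm_sub_norm_le _ _).trans ?_
    rw [sub_sub_sub_cancel_right]
    exact norm_exp_sub_exp_le x y
  have hsub : Ioc 0 ‖ξ - a‖ ⊆ g '' angSet γ := by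
    intro s hs
    obtain ⟨ζ, hζ, hζa⟩ := Metric.mem_closure_iff.1 ha s hs.1
    have h1 : ‖ζ - a‖ ≤ s := by rw [← dist_eq_norm, dist_comm]; exact hζa.le
    obtain ⟨η, hη, hηs⟩ := hc.intermediate_value hζ hξ
      (f := fun w : ℂ => ‖w - a‖) (by fun_prop) ⟨h1, hs.2⟩
    obtain ⟨θ, hθ, hθη⟩ := exists_mem_angSet hγ hη
    exact ⟨θ, hθ, by rw [hg]; simp only [hθη]; exact hηs⟩
  calc ENNReal.ofReal ‖ξ - a‖ = volume (Ioc 0 ‖ξ - a‖) := by rw [Real.volume_Ioc, sub_zero]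
    _ ≤ volume (g '' angSet γ) := measure_mono hsub
    _ ≤ volume (angSet γ) := by
      have := hlip.hausdorffMeasure_image_le zero_le_one (angSet γ)
      rwa [hausdorffMeasure_real, ENNReal.coe_one, ENNReal.one_rpow, one_mul] at this

/-- A sector over a short connected arc is star-shaped with respect to the boundary points
of the arc. -/
lemma discSector_starShaped {γ : Set ℂ} (hγ : γ ⊆ uCircle) (hc : IsPreconnected γ)
    (hvol : volume (angSet γ) < ENNReal.ofReal (1 / 2)) {a : ℂ} (ha : a ∈ closure γ)
    (haγ : a ∉ γ) (hna : ‖a‖ = 1) {z : ℂ} (hz : z ∈ discSector γ) {t : ℝ} (ht : t ∈ Ioc (0 : ℝ) 1) :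
    a + t * (z - a) ∈ discSector γ := by
  obtain ⟨hzd, hξ⟩ := hz
  have hz1 := uDisc_norm_lt hzd
  set r := ‖z‖ with hr
  set ξ := ((r : ℂ))⁻¹ * z with hξdef
  have hnξ : ‖ξ‖ = 1 := by simpa [uCircle] using hγ hξ
  have hr0 : 0 < r := by
    rw [hr, norm_pos_iff]
    rintro rfl
    simp [hξdef] at hnξ
  have hzξ : z = r * ξ := by
    rw [hξdef, mul_inv_cancel_left₀]
    exact_mod_cast hr0.ne'
  have hconj : a * (starRingEnd ℂ) a = 1 := by
    rw [Complex.mul_conj, Complex.normSq_eq_norm_sq, hna]; norm_num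
  have hnear : ∀ η ∈ insert a γ, 0 < (η * (starRingEnd ℂ) a).re := by
    intro η hη
    have h1 : ‖η - a‖ < 1 / 2 := by
      rcases hη with rfl | hη
      · simp
      · exact (ENNReal.ofReal_lt_ofReal_iff (by norm_num)).1
          ((ofReal_norm_sub_le_volume_angSet hγ hc ha hη).trans_lt hvol)
    have h2 : η * (starRingEnd ℂ) a = 1 + (η - a) * (starRingEnd ℂ) a := by
      rw [sub_mul, hconj]; ring
    have h3 := Complex.abs_re_le_norm ((η - a) * (starRingEnd ℂ) a)
    rw [norm_mul, Complex.norm_conj, hna, mul_one] at h3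
    rw [h2, Complex.add_re, Complex.one_re]
    linarith [(abs_le.1 h3).1]
  have hnorm : ∀ η ∈ insert a γ, ‖η‖ = 1 := by
    rintro η (rfl | hη)
    · exact hna
    · simpa [uCircle] using hγ hη
  have hsq : ∀ η : ℂ, ‖η‖ = 1 →
      (η * (starRingEnd ℂ) a).re ^ 2 + (η * (starRingEnd ℂ) a).im ^ 2 = 1 := by
    intro η hη
    have := Complex.normSq_eq_norm_sq (η * (starRingEnd ℂ) a)
    rw [norm_mul, Complex.norm_conj, hna, hη, Complex.normSq_apply] at this
    linarith
  have hext : ∀ η ζ : ℂ, (η * (starRingEnd ℂ) a) = (ζ * (starRingEnd ℂ) a) → η = ζ := by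
    intro η ζ h
    exact mul_right_cancel₀ (right_ne_zero_of_mul_eq_one hconj) h
  set c := (ξ * (starRingEnd ℂ) a).re with hcdef
  set s := (ξ * (starRingEnd ℂ) a).im with hsdef
  have hc0 : 0 < c := hnear ξ (Or.inr hξ)
  have hcs : c ^ 2 + s ^ 2 = 1 := hsq ξ hnξ
  set w := a + t * (z - a) with hw
  have hwa : w * (starRingEnd ℂ) a = ((1 - t : ℝ) : ℂ) + ((t * r : ℝ) : ℂ) *
      (ξ * (starRingEnd ℂ) a) := by
    have : w = ((1 - t : ℝ) : ℂ) * a + ((t * r : ℝ) : ℂ) * ξ := by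
      rw [hw, hzξ]; push_cast; ring
    rw [this, add_mul, mul_assoc, hconj, mul_one, mul_assoc]
  have hwre : (w * (starRingEnd ℂ) a).re = (1 - t) + t * r * c := by
    rw [hwa, Complex.add_re, Complex.re_ofReal_mul, Complex.ofReal_re]
  have hwim : (w * (starRingEnd ℂ) a).im = t * r * s := by
    rw [hwa, Complex.add_im, Complex.im_ofReal_mul, Complex.ofReal_im, zero_add]
  have htr : 0 < t * r := mul_pos ht.1 hr0
  have hwn : ‖w‖ ^ 2 = ((1 - t) + t * r * c) ^ 2 + (t * r * s) ^ 2 := by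
    have := Complex.normSq_eq_norm_sq (w * (starRingEnd ℂ) a)
    rw [norm_mul, Complex.norm_conj, hna, mul_one, Complex.normSq_apply, hwre, hwim] at this
    linarith
  have hwge : t * r ≤ ‖w‖ := by
    refine abs_le_of_sq_le_sq' ?_ (norm_nonneg _) |>.2
    rw [hwn]
    have h1 : 0 ≤ (1 - t) * (t * r * c) := mul_nonneg (by linarith [ht.2]) (by positivity)
    have h2 : (t * r) ^ 2 = (t * r) ^ 2 * (c ^ 2 + s ^ 2) := by rw [hcs, mul_one]
    nlinarith [sq_nonneg (1 - t)]
  have hw0 : 0 < ‖w‖ := htr.trans_le hwge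
  have hwd : w ∈ uDisc := by
    have := norm_segment_le (z := z) hna (Ioc_subset_Icc_self ht)
    simp only [uDisc, mem_ball_zero_iff]
    nlinarith [ht.1]
  refine ⟨hwd, ?_⟩
  set p := ((‖w‖ : ℂ))⁻¹ * w with hp
  have hpn : ‖p‖ = 1 := by
    rw [hp, norm_mul, norm_inv, Complex.norm_real, norm_norm, inv_mul_cancel₀ hw0.ne']
  have hpa : p * (starRingEnd ℂ) a = ((‖w‖⁻¹ : ℝ) : ℂ) * (w * (starRingEnd ℂ) a) := by
    rw [hp]; push_cast; ring
  have hpre : 0 < (p * (starRingEnd ℂ) a).re := by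
    rw [hpa, Complex.re_ofReal_mul, hwre]
    have : 0 ≤ 1 - t := by linarith [ht.2]
    positivity
  have hpim : (p * (starRingEnd ℂ) a).im = (t * r / ‖w‖) * s := by
    rw [hpa, Complex.im_ofReal_mul, hwim]
    ring
  have hl0 : 0 < t * r / ‖w‖ := div_pos htr hw0
  have hl1 : t * r / ‖w‖ ≤ 1 := (div_le_one hw0).2 hwge
  set l := t * r / ‖w‖
  have hK : IsPreconnected (insert a γ) :=
    hc.subset_closure (subset_insert _ _) (insert_subset ha subset_closure)
  obtain ⟨η, hη, hηim⟩ : ∃ η ∈ insert a γ, (η * (starRingEnd ℂ) a).im = l * s := by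
    have haim : (a * (starRingEnd ℂ) a).im = 0 := by rw [hconj, Complex.one_im]
    have hcont : ContinuousOn (fun η : ℂ => (η * (starRingEnd ℂ) a).im) (insert a γ) := by
      fun_prop
    rcases le_total 0 s with h | h
    · exact hK.intermediate_value (mem_insert a γ) (Or.inr hξ) hcont
        ⟨by simp only [haim]; positivity, by nlinarith⟩
    · exact hK.intermediate_value (Or.inr hξ) (mem_insert a γ) hcont
        ⟨by nlinarith, by simp only [haim]; nlinarith⟩
  have hηp : η = p := by
    apply hext
    apply Complex.ext
    · have h1 := hsq η (hnorm η hη)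
      have h2 := hsq p hpn
      rw [hpim] at h2
      rw [hηim] at h1
      have h3 := hnear η hη
      exact (sq_eq_sq₀ h3.le hpre.le).1 (by linarith)
    · rw [hηim, hpim]
  rw [← hηp]
  rcases hη with rfl | hη
  · exfalso
    rw [hconj, Complex.one_im] at hηim
    have hs0 : s = 0 := by
      rcases mul_eq_zero.1 hηim.symm with h | h
      · exact absurd h hl0.ne'
      · exact h
    have hc1 : c = 1 := by nlinarith
    apply haγ
    have : ξ = η := by
      apply hext
      rw [hconj]
      exact Complex.ext hc1 hs0
    rwa [← this]
  · exact hη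

lemma lintegral_comp_homothety (a : ℂ) {t : ℝ} (ht : 0 < t) {F : ℂ → ℝ≥0∞} (hF : Measurable F) :
    ∫⁻ z, F (a + t * (z - a)) = ENNReal.ofReal t ^ (-2 : ℝ) * ∫⁻ w, F w := by
  have h1 : ∀ z : ℂ, a + t * (z - a) = t • z + (a - t * a) := by
    intro z
    rw [Complex.real_smul]; ring
  simp_rw [h1]
  have hF' : Measurable fun w => F (w + (a - t * a)) := hF.comp (measurable_add_const _)
  rw [← lintegral_map hF' (measurable_const_smul t), Measure.map_addHaar_smul _ ht.ne',
    lintegral_smul_measure, lintegral_add_right_eq_self, smul_eq_mul, Complex.finrank_real_complex,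
    abs_of_nonneg (by positivity), ENNReal.ofReal_rpow_of_pos ht, Real.rpow_neg ht.le]
  norm_num

lemma lintegral_ofReal_rpow_lt_top {s : ℝ} (hs : -1 < s) :
    ∫⁻ t in Ioo (0 : ℝ) 1, ENNReal.ofReal t ^ s < ⊤ := by
  have h := (intervalIntegral.integrableOn_Ioo_rpow_iff (s := s) one_pos).2 hs
  refine lt_of_le_of_lt (le_of_eq ?_) h.2
  refine setLIntegral_congr_fun measurableSet_Ioo fun t ht => ?_
  simp only
  rw [ENNReal.ofReal_rpow_of_pos ht.1, Real.enorm_of_nonneg (Real.rpow_nonneg ht.1.le _)]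

/-- The constant in the Hölder estimate along segments. -/
noncomputable def segmentConst (p κ : ℝ) : ℝ≥0∞ :=
  (∫⁻ t in Ioo (0 : ℝ) 1, ENNReal.ofReal t ^ (-(1 - κ / (p - 1)))) ^ (p - 1) * 2 ^ (p - 2)

lemma segmentConst_lt_top {p κ : ℝ} (hp : 2 < p) (hκ : 0 < κ) : segmentConst p κ < ⊤ := by
  have h1 : 0 < κ / (p - 1) := div_pos hκ (by linarith)
  exact ENNReal.mul_lt_top
    (ENNReal.rpow_lt_top_of_nonneg (by linarith)
      (lintegral_ofReal_rpow_lt_top (by linarith)).ne)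
    (ENNReal.rpow_lt_top_of_nonneg (by linarith) (by simp))

lemma enorm_rpow_le_lintegral_segment {α p : ℝ} (hα0 : 0 < α) (hα1 : α ≤ 1) (hp : 2 < p)
    {f : ℂ → ℂ} (hf : IsDiscReg f) (hd : ∀ z ∈ uDisc, ‖deriv f z‖ ≤ (1 - ‖z‖) ^ (α - 1))
    {a z : ℂ} (ha : a ∈ bZeros f) (hz : z ∈ uDisc) (hza : ‖z - a‖ < 2 * (1 - ‖z‖)) :
    ‖f z‖ₑ ^ p ≤ segmentConst p (α * (p - 2) / 2) * (‖z - a‖ₑ ^ (2 : ℝ) *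
      ∫⁻ t in Ioo (0 : ℝ) 1, ENNReal.ofReal t ^ (1 + α * (p - 2) / 2) *
        ‖deriv f (a + t * (z - a))‖ₑ ^ (2 : ℝ)) := by
  set κ := α * (p - 2) / 2 with hκ
  have hna : ‖a‖ = 1 := by simpa [bZeros, uCircle] using ha.1
  have hz1 := uDisc_norm_lt hz
  have hu0 : 0 < ‖z - a‖ := by
    have := norm_sub_norm_le a z
    rw [norm_sub_rev] at this
    linarith
  have hu2 : ‖z - a‖ ≤ 2 := by linarith [norm_sub_le z a]
  set A : ℝ → ℝ≥0∞ := fun t => ‖z - a‖ₑ * ‖deriv f (a + t * (z - a))‖ₑ with hA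
  have hAm : Measurable A :=
    ((measurable_deriv f).comp (by fun_prop)).enorm.const_mul _
  have hTm : ∀ s : ℝ, Measurable fun t : ℝ => ENNReal.ofReal t ^ s :=
    fun s => ENNReal.measurable_ofReal.pow_const s
  set σ := (p - 1 - κ) / p with hσ
  have hp0 : 0 < p := by linarith
  have hpq : (p / (p - 1)).HolderConjugate p :=
    (Real.HolderConjugate.conjExponent (by linarith : 1 < p)).symm
  have hbase := enorm_le_lintegral_segment hα0 hα1 hf hd ha hz
  have hsplit : ∫⁻ t in Ioo (0 : ℝ) 1, A t = ∫⁻ t in Ioo (0 : ℝ) 1,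
      ((fun t => ENNReal.ofReal t ^ (-σ)) * (fun t => ENNReal.ofReal t ^ σ * A t)) t := by
    refine setLIntegral_congr_fun measurableSet_Ioo fun t ht => ?_
    simp only [Pi.mul_apply]
    rw [← mul_assoc, ← ENNReal.rpow_add _ _ (by simpa using ht.1) (by simp), neg_add_cancel,
      ENNReal.rpow_zero, one_mul]
  have hold := ENNReal.lintegral_mul_le_Lp_mul_Lq (volume.restrict (Ioo (0 : ℝ) 1)) hpq
    (hTm (-σ)).aemeasurable ((hTm σ).mul hAm).aemeasurable
  have hptw : ∀ t ∈ Ioo (0 : ℝ) 1, (ENNReal.ofReal t ^ σ * A t) ^ p ≤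
      2 ^ (p - 2) * (‖z - a‖ₑ ^ (2 : ℝ) * (ENNReal.ofReal t ^ (1 + κ) *
        ‖deriv f (a + t * (z - a))‖ₑ ^ (2 : ℝ))) := by
    intro t ht
    have hT0 : ENNReal.ofReal t ≠ 0 := by simpa using ht.1
    have hAle : A t ≤ 2 * ENNReal.ofReal t ^ (α - 1) := by
      have hseg := norm_segment_le (z := z) hna (Ioo_subset_Icc_self ht)
      have hmem : a + t * (z - a) ∈ uDisc := by
        simp only [uDisc, mem_ball_zero_iff]
        nlinarith [ht.1]
      have h1 : ‖deriv f (a + t * (z - a))‖ ≤ (t * (‖z - a‖ / 2)) ^ (α - 1) := by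
        refine (hd _ hmem).trans (Real.rpow_le_rpow_of_nonpos (mul_pos ht.1 (by positivity)) ?_
          (by linarith))
        refine le_trans ?_ hseg
        gcongr
        · exact ht.1.le
        · linarith
      have h2 : ‖z - a‖ * ‖deriv f (a + t * (z - a))‖ ≤ 2 * t ^ (α - 1) := by
        calc _ ≤ ‖z - a‖ * (t * (‖z - a‖ / 2)) ^ (α - 1) := by gcongr
          _ = 2 * t ^ (α - 1) * (‖z - a‖ / 2) ^ α := by
            rw [Real.mul_rpow ht.1.le (by positivity), Real.rpow_sub_one (x := ‖z - a‖ / 2) (by positivity)]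
            field_simp
          _ ≤ 2 * t ^ (α - 1) * 1 := by
            gcongr
            · exact mul_nonneg zero_le_two (Real.rpow_nonneg ht.1.le _)
            · exact Real.rpow_le_one (by positivity) (by linarith) hα0.le
          _ = _ := mul_one _
      rw [hA]
      simp only
      rw [← ofReal_norm, ← ofReal_norm, ← ENNReal.ofReal_mul (norm_nonneg _),
        ENNReal.ofReal_rpow_of_pos ht.1]
      refine (ENNReal.ofReal_le_ofReal h2).trans_eq ?_
      rw [ENNReal.ofReal_mul zero_le_two]
      norm_num
    calc (ENNReal.ofReal t ^ σ * A t) ^ p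
        = ENNReal.ofReal t ^ (σ * p) * (A t ^ (p - 2) * A t ^ (2 : ℝ)) := by
          rw [ENNReal.mul_rpow_of_nonneg _ _ hp0.le, ← ENNReal.rpow_mul,
            ← ENNReal.rpow_add_of_nonneg _ _ (by linarith) (by norm_num), sub_add_cancel]
      _ ≤ ENNReal.ofReal t ^ (σ * p) *
          ((2 * ENNReal.ofReal t ^ (α - 1)) ^ (p - 2) * A t ^ (2 : ℝ)) := by
          gcongr
      _ = 2 ^ (p - 2) * (‖z - a‖ₑ ^ (2 : ℝ) *
          ((ENNReal.ofReal t ^ (σ * p) * ENNReal.ofReal t ^ ((α - 1) * (p - 2))) *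
            ‖deriv f (a + t * (z - a))‖ₑ ^ (2 : ℝ))) := by
          rw [ENNReal.mul_rpow_of_nonneg _ _ (by linarith), ← ENNReal.rpow_mul, hA,
            ENNReal.mul_rpow_of_nonneg _ _ zero_le_two]
          ring
      _ = _ := by
          have e : σ * p + (α - 1) * (p - 2) = 1 + κ := by
            rw [hσ, hκ]
            field_simp
            ring
          rw [← ENNReal.rpow_add _ _ hT0 (by simp), e]
  calc ‖f z‖ₑ ^ p ≤ ((∫⁻ t in Ioo (0 : ℝ) 1, (ENNReal.ofReal t ^ (-σ)) ^ (p / (p - 1))) ^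
        (1 / (p / (p - 1))) * (∫⁻ t in Ioo (0 : ℝ) 1, (ENNReal.ofReal t ^ σ * A t) ^ p) ^
          (1 / p)) ^ p := by
        gcongr
        exact hbase.trans (hsplit.trans_le hold)
    _ = (∫⁻ t in Ioo (0 : ℝ) 1, ENNReal.ofReal t ^ (-(1 - κ / (p - 1)))) ^ (p - 1) *
        ∫⁻ t in Ioo (0 : ℝ) 1, (ENNReal.ofReal t ^ σ * A t) ^ p := by
        rw [ENNReal.mul_rpow_of_nonneg _ _ hp0.le, ← ENNReal.rpow_mul, ← ENNReal.rpow_mul,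
          one_div_mul_cancel hp0.ne', ENNReal.rpow_one]
        have hp1 : p - 1 ≠ 0 := by linarith
        have e1 : 1 / (p / (p - 1)) * p = p - 1 := by field_simp
        have e2 : -σ * (p / (p - 1)) = -(1 - κ / (p - 1)) := by rw [hσ]; field_simp
        simp_rw [← ENNReal.rpow_mul, e1, e2]
    _ ≤ (∫⁻ t in Ioo (0 : ℝ) 1, ENNReal.ofReal t ^ (-(1 - κ / (p - 1)))) ^ (p - 1) *
        ∫⁻ t in Ioo (0 : ℝ) 1, 2 ^ (p - 2) * (‖z - a‖ₑ ^ (2 : ℝ) * (ENNReal.ofReal t ^ (1 + κ) *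
        ‖deriv f (a + t * (z - a))‖ₑ ^ (2 : ℝ))) := by
        exact mul_le_mul' le_rfl (setLIntegral_mono' measurableSet_Ioo hptw)
    _ = _ := by
        have hm : Measurable fun t : ℝ => ENNReal.ofReal t ^ (1 + κ) *
            ‖deriv f (a + t * (z - a))‖ₑ ^ (2 : ℝ) :=
          (hTm _).mul (((measurable_deriv f).comp (by fun_prop)).enorm.pow_const _)
        rw [lintegral_const_mul _ (hm.const_mul _), lintegral_const_mul _ hm, segmentConst]
        ring

/-- A Hardy-type inequality on regions which are star-shaped with respect to a boundary zero
and approach it nontangentially. -/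
lemma lintegral_hardy_starShaped {α p : ℝ} (hα0 : 0 < α) (hα1 : α ≤ 1) (hp : 2 < p)
    {f : ℂ → ℂ} (hf : IsDiscReg f) (hd : ∀ z ∈ uDisc, ‖deriv f z‖ ≤ (1 - ‖z‖) ^ (α - 1))
    {a : ℂ} (ha : a ∈ bZeros f) {S : Set ℂ} (hS : MeasurableSet S) (hSd : S ⊆ uDisc)
    (hSa : ∀ z ∈ S, ‖z - a‖ < 2 * (1 - ‖z‖))
    (hstar : ∀ z ∈ S, ∀ t ∈ Ioc (0 : ℝ) 1, a + t * (z - a) ∈ S) :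
    ∫⁻ z in S, ‖f z‖ₑ ^ p * ‖z - a‖ₑ ^ (-2 : ℝ) ≤
      segmentConst p (α * (p - 2) / 2) *
        (∫⁻ t in Ioo (0 : ℝ) 1, ENNReal.ofReal t ^ (-1 + α * (p - 2) / 2)) *
          ∫⁻ z in S, ‖deriv f z‖ₑ ^ (2 : ℝ) := by
  set κ := α * (p - 2) / 2 with hκ
  set M := segmentConst p κ
  have hTm : ∀ s : ℝ, Measurable fun t : ℝ => ENNReal.ofReal t ^ s :=
    fun s => ENNReal.measurable_ofReal.pow_const s
  have hdm : Measurable fun w => ‖deriv f w‖ₑ ^ (2 : ℝ) := (measurable_deriv f).enorm.pow_const _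
  have hGm : Measurable fun q : ℂ × ℝ => ENNReal.ofReal q.2 ^ (1 + κ) *
      ‖deriv f (a + q.2 * (q.1 - a))‖ₑ ^ (2 : ℝ) :=
    ((hTm _).comp measurable_snd).mul (hdm.comp (by fun_prop))
  have hptw : ∀ z ∈ S, ‖f z‖ₑ ^ p * ‖z - a‖ₑ ^ (-2 : ℝ) ≤ M * ∫⁻ t in Ioo (0 : ℝ) 1,
      ENNReal.ofReal t ^ (1 + κ) * ‖deriv f (a + t * (z - a))‖ₑ ^ (2 : ℝ) := by
    intro z hz
    have hne : ‖z - a‖ₑ ≠ 0 := by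
      rw [enorm_ne_zero, sub_ne_zero]
      rintro rfl
      have h1 : ‖z‖ = 1 := by simpa [bZeros, uCircle] using ha.1
      exact (uDisc_norm_lt (hSd hz)).ne h1
    have h := enorm_rpow_le_lintegral_segment hα0 hα1 hp hf hd ha (hSd hz) (hSa z hz)
    calc _ ≤ M * (‖z - a‖ₑ ^ (2 : ℝ) * ∫⁻ t in Ioo (0 : ℝ) 1, ENNReal.ofReal t ^ (1 + κ) *
          ‖deriv f (a + t * (z - a))‖ₑ ^ (2 : ℝ)) * ‖z - a‖ₑ ^ (-2 : ℝ) := by gcongr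
      _ = M * (∫⁻ t in Ioo (0 : ℝ) 1, ENNReal.ofReal t ^ (1 + κ) *
          ‖deriv f (a + t * (z - a))‖ₑ ^ (2 : ℝ)) *
            (‖z - a‖ₑ ^ (2 : ℝ) * ‖z - a‖ₑ ^ (-2 : ℝ)) := by ring
      _ = _ := by
        rw [← ENNReal.rpow_add _ _ hne enorm_ne_top, add_neg_cancel, ENNReal.rpow_zero, mul_one]
  have hscale : ∀ t ∈ Ioo (0 : ℝ) 1, ∫⁻ z in S, ENNReal.ofReal t ^ (1 + κ) *
      ‖deriv f (a + t * (z - a))‖ₑ ^ (2 : ℝ) ≤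
      ENNReal.ofReal t ^ (-1 + κ) * ∫⁻ z in S, ‖deriv f z‖ₑ ^ (2 : ℝ) := by
    intro t ht
    have hT0 : ENNReal.ofReal t ≠ 0 := by simpa using ht.1
    have hm : Measurable fun z : ℂ => ‖deriv f (a + t * (z - a))‖ₑ ^ (2 : ℝ) :=
      hdm.comp (by fun_prop : Measurable fun z : ℂ => a + t * (z - a))
    rw [lintegral_const_mul _ hm]
    have h1 : ∫⁻ z in S, ‖deriv f (a + t * (z - a))‖ₑ ^ (2 : ℝ) ≤
        ENNReal.ofReal t ^ (-2 : ℝ) * ∫⁻ z in S, ‖deriv f z‖ₑ ^ (2 : ℝ) := by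
      rw [← lintegral_indicator hS, ← lintegral_indicator hS,
        ← lintegral_comp_homothety a ht.1 (hdm.indicator hS)]
      refine lintegral_mono fun z => ?_
      by_cases hz : z ∈ S
      · rw [indicator_of_mem hz, indicator_of_mem (hstar z hz t ⟨ht.1, ht.2.le⟩)]
      · rw [indicator_of_notMem hz]
        exact zero_le
    refine (mul_le_mul' le_rfl h1).trans_eq ?_
    rw [← mul_assoc, ← ENNReal.rpow_add _ _ hT0 (by simp)]
    ring_nf
  calc _ ≤ ∫⁻ z in S, M * ∫⁻ t in Ioo (0 : ℝ) 1, ENNReal.ofReal t ^ (1 + κ) *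
        ‖deriv f (a + t * (z - a))‖ₑ ^ (2 : ℝ) := setLIntegral_mono' hS hptw
    _ = M * ∫⁻ t in Ioo (0 : ℝ) 1, ∫⁻ z in S, ENNReal.ofReal t ^ (1 + κ) *
        ‖deriv f (a + t * (z - a))‖ₑ ^ (2 : ℝ) := by
      rw [lintegral_const_mul _ hGm.lintegral_prod_right', lintegral_lintegral_swap hGm.aemeasurable]
    _ ≤ M * ∫⁻ t in Ioo (0 : ℝ) 1, ENNReal.ofReal t ^ (-1 + κ) *
        ∫⁻ z in S, ‖deriv f z‖ₑ ^ (2 : ℝ) := by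
      exact mul_le_mul' le_rfl (setLIntegral_mono' measurableSet_Ioo hscale)
    _ = _ := by
      rw [lintegral_mul_const _ (hTm _), mul_assoc]

lemma measurableSet_discSector {γ : Set ℂ} (hγ : MeasurableSet γ) :
    MeasurableSet (discSector γ) := by
  have hm : Measurable fun z : ℂ => ((‖z‖ : ℂ))⁻¹ * z :=
    (Complex.measurable_ofReal.comp measurable_norm).inv.mul measurable_id
  exact measurableSet_ball.inter (hm hγ)

lemma rpow_mul_log_sq_le {x ρ : ℝ} (hx0 : 0 < x) (hx1 : x ≤ 1) (hρ : 1 < ρ) :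
    x ^ (2 * ρ) * (-Real.log x) ^ 2 ≤ (2 / (ρ - 1)) ^ 2 * x ^ (1 + ρ) := by
  have hc : 0 < (ρ - 1) / 2 := by linarith
  have h := (Real.abs_log_mul_self_rpow_lt x ((ρ - 1) / 2) hx0 hx1 hc).le
  have e : x ^ (2 * ρ) = x ^ (1 + ρ) * (x ^ ((ρ - 1) / 2)) ^ 2 := by
    rw [← Real.rpow_natCast, ← Real.rpow_mul hx0.le, ← Real.rpow_add hx0]
    congr 1
    push_cast
    ring
  have e2 : 1 / ((ρ - 1) / 2) = 2 / (ρ - 1) := by rw [one_div_div]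
  rw [e2] at h
  calc _ = (Real.log x * x ^ ((ρ - 1) / 2)) ^ 2 * x ^ (1 + ρ) := by rw [e]; ring
    _ ≤ _ := by
      rw [← sq_abs]
      gcongr

/-- The pointwise bound of the integrand in the nontangential region at a boundary point `a`. -/
lemma rpow_mul_norm_deriv_outerPart_sq_le {f : ℂ → ℂ} (hf : IsOuter f)
    (hl : IntegrableOn (fun θ : ℝ => Real.log ‖f (exp (θ * I))‖) (Icc 0 (2 * Real.pi)))
    (hf1 : ∀ z ∈ closedBall (0 : ℂ) 1, ‖f z‖ ≤ 1) (Γ : Set ℂ) {ρ : ℝ} (hρ : 1 < ρ) {a z : ℂ}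
    (hz : z ∈ uDisc) (hne : z ≠ a) (hza : ‖z - a‖ < 2 * (1 - ‖z‖)) :
    ‖f z‖ ^ (2 * ρ) * ‖deriv (outerPart f Γ) z‖ ^ 2 ≤
      (8 / (ρ - 1)) ^ 2 * (‖f z‖ ^ (1 + ρ) * ‖z - a‖ ^ (-2 : ℝ)) := by
  have hu : 0 < ‖z - a‖ := norm_pos_iff.2 (sub_ne_zero.2 hne)
  have h1z : 0 < 1 - ‖z‖ := by linarith
  have hx0 : 0 < ‖f z‖ := by
    rw [hf.2.2 z hz]
    exact norm_pos_iff.2 (exp_ne_zero _)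
  have hx1 : ‖f z‖ ≤ 1 := hf1 z (ball_subset_closedBall hz)
  have hD := norm_deriv_outerPart_le hf hl
    (fun θ => hf1 _ (by simp [Complex.norm_exp_ofReal_mul_I])) Γ hz
  have hL : 0 ≤ -Real.log ‖f z‖ := by linarith [Real.log_nonpos hx0.le hx1]
  have hD' : ‖deriv (outerPart f Γ) z‖ ≤ 4 * (-Real.log ‖f z‖) / ‖z - a‖ := by
    refine hD.trans ?_
    rw [div_le_div_iff₀ h1z hu]
    nlinarith
  calc _ ≤ ‖f z‖ ^ (2 * ρ) * (4 * (-Real.log ‖f z‖) / ‖z - a‖) ^ 2 := by gcongr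
    _ = 16 * (‖f z‖ ^ (2 * ρ) * (-Real.log ‖f z‖) ^ 2) * ‖z - a‖ ^ (-2 : ℝ) := by
      rw [Real.rpow_neg hu.le, Real.rpow_two]
      field_simp
      ring
    _ ≤ 16 * ((2 / (ρ - 1)) ^ 2 * ‖f z‖ ^ (1 + ρ)) * ‖z - a‖ ^ (-2 : ℝ) := by
      gcongr 16 * ?_ * _
      exact rpow_mul_log_sq_le hx0 hx1 hρ
    _ = _ := by ring

/-- The constant of the estimate over the nontangential region at one endpoint. -/
noncomputable def endpointConst (α ρ : ℝ) : ℝ≥0∞ :=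
  ENNReal.ofReal ((8 / (ρ - 1)) ^ 2) * (segmentConst (1 + ρ) (α * (1 + ρ - 2) / 2) *
    ∫⁻ t in Ioo (0 : ℝ) 1, ENNReal.ofReal t ^ (-1 + α * (1 + ρ - 2) / 2))

lemma endpointConst_lt_top {α ρ : ℝ} (hα0 : 0 < α) (hρ : 1 < ρ) : endpointConst α ρ < ⊤ := by
  have hκ : 0 < α * (1 + ρ - 2) / 2 := by
    have : 0 < α * (1 + ρ - 2) := mul_pos hα0 (by linarith)
    linarith
  exact ENNReal.mul_lt_top ENNReal.ofReal_lt_top (ENNReal.mul_lt_top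
    (segmentConst_lt_top (by linarith) hκ) (lintegral_ofReal_rpow_lt_top (by linarith)))

lemma lintegral_endpoint_le {α ρ : ℝ} (hα0 : 0 < α) (hα1 : α ≤ 1) (hρ : 1 < ρ) {f : ℂ → ℂ}
    {Γ γ : Set ℂ} {a : ℂ} (hlip : MemLip α f) (hf : IsOuter f) (hn : ANorm α f ≤ 1)
    (hγ : IsCompArc f γ) (hm : MeasurableSet γ)
    (hvol : volume (angSet γ) < ENNReal.ofReal (1 / 2)) (ha : a ∈ bZeros f)
    (haγ : a ∈ closure γ) :
    ∫⁻ z in {z | z ∈ discSector γ ∧ ‖z - a‖ < 2 * (1 - ‖z‖)},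
        ENNReal.ofReal (‖f z‖ ^ (2 * ρ) * ‖deriv (outerPart f Γ) z‖ ^ 2) ≤
      endpointConst α ρ * ∫⁻ z in discSector γ, ENNReal.ofReal (‖deriv f z‖ ^ 2) := by
  set S := {z | z ∈ discSector γ ∧ ‖z - a‖ < 2 * (1 - ‖z‖)} with hSdef
  obtain ⟨x, -, rfl⟩ := hγ
  set γ := connectedComponentIn (offZeros f) x
  have hoff : γ ⊆ offZeros f := connectedComponentIn_subset _ _
  have hna : ‖a‖ = 1 := by simpa [bZeros, uCircle] using ha.1
  have hcone : MeasurableSet {z : ℂ | ‖z - a‖ < 2 * (1 - ‖z‖)} :=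
    measurableSet_lt (by fun_prop) (by fun_prop)
  have hS : MeasurableSet S := (measurableSet_discSector hm).inter hcone
  have hSd : S ⊆ uDisc := fun z hz => hz.1.1
  have hSne : ∀ z ∈ S, z ≠ a := by
    rintro z hz rfl
    exact (uDisc_norm_lt (hSd hz)).ne hna
  have hstar : ∀ z ∈ S, ∀ t ∈ Ioc (0 : ℝ) 1, a + t * (z - a) ∈ S := by
    intro z hz t ht
    refine ⟨discSector_starShaped (fun y hy => (hoff hy).1) isPreconnected_connectedComponentIn
      hvol haγ (fun h => (hoff h).2 ha.2) hna hz.1 ht, ?_⟩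
    have hseg := norm_segment_le (z := z) hna (Ioc_subset_Icc_self ht)
    have : ‖a + t * (z - a) - a‖ = t * ‖z - a‖ := by
      rw [add_sub_cancel_left, norm_mul, Complex.norm_of_nonneg ht.1.le]
    rw [this]
    nlinarith [hz.2, ht.1]
  have hH := lintegral_hardy_starShaped (p := 1 + ρ) hα0 hα1 (by linarith) hlip.1
    (fun z hz => norm_deriv_le_of_ANorm_le hlip hn hz) ha hS hSd (fun z hz => hz.2) hstar
  have hptw : ∀ z ∈ S, ENNReal.ofReal (‖f z‖ ^ (2 * ρ) * ‖deriv (outerPart f Γ) z‖ ^ 2) ≤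
      ENNReal.ofReal ((8 / (ρ - 1)) ^ 2) * (‖f z‖ₑ ^ (1 + ρ) * ‖z - a‖ₑ ^ (-2 : ℝ)) := by
    intro z hz
    refine (ENNReal.ofReal_le_ofReal (rpow_mul_norm_deriv_outerPart_sq_le hf
      (integrableOn_log_of_outer hf ha) (fun z hz => norm_le_one_of_ANorm_le hlip hn hz) Γ hρ
      (hSd hz) (hSne z hz) hz.2)).trans_eq ?_
    have hu : 0 < ‖z - a‖ := norm_pos_iff.2 (sub_ne_zero.2 (hSne z hz))
    rw [ENNReal.ofReal_mul (by positivity), ENNReal.ofReal_mul (by positivity),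
      ← ofReal_norm, ← ofReal_norm, ENNReal.ofReal_rpow_of_pos hu,
      ENNReal.ofReal_rpow_of_nonneg (norm_nonneg _) (by linarith)]
  calc _ ≤ ∫⁻ z in S, ENNReal.ofReal ((8 / (ρ - 1)) ^ 2) *
        (‖f z‖ₑ ^ (1 + ρ) * ‖z - a‖ₑ ^ (-2 : ℝ)) := setLIntegral_mono' hS hptw
    _ = ENNReal.ofReal ((8 / (ρ - 1)) ^ 2) *
        ∫⁻ z in S, ‖f z‖ₑ ^ (1 + ρ) * ‖z - a‖ₑ ^ (-2 : ℝ) :=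
      lintegral_const_mul' _ _ ENNReal.ofReal_ne_top
    _ ≤ endpointConst α ρ * ∫⁻ z in S, ‖deriv f z‖ₑ ^ (2 : ℝ) := by
      rw [endpointConst, mul_assoc]
      exact mul_le_mul' le_rfl hH
    _ ≤ endpointConst α ρ * ∫⁻ z in discSector γ, ENNReal.ofReal (‖deriv f z‖ ^ 2) := by
      refine mul_le_mul' le_rfl ((lintegral_mono_set fun z hz => hz.1).trans_eq ?_)
      refine lintegral_congr fun z => ?_
      rw [← ofReal_norm, ENNReal.ofReal_rpow_of_nonneg (norm_nonneg _) zero_le_two, Real.rpow_two]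

/-- `∫_{Δ_γ¹} |f|^{2ρ} |f_Γ'|² dA ≤ C_ρ ‖f'‖²_{L²(Δ_γ)}`. -/
theorem sector1_est (α ρ : ℝ) (hα0 : 0 < α) (hα1 : α ≤ 1/2) (hρ1 : 1 < ρ) (hρ2 : ρ ≤ 2) :
    ∃ C : ℝ, 0 < C ∧ ∀ (f : ℂ → ℂ) (Γ γ : Set ℂ) (a b : ℂ),
      MemA α f → IsOuter f → ANorm α f ≤ 1 → IsArcUnion f Γ →
      IsCompArc f γ → volume (angSet γ) < ENNReal.ofReal (1/2) →
      a ∈ bZeros f → b ∈ bZeros f → closure γ = insert a (insert b γ) →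
      nlint (sector1 a b γ)
          (fun z => ‖f z‖ ^ (2 * ρ) * ‖deriv (outerPart f Γ) z‖ ^ 2) ≤
        ENNReal.ofReal C * nlint (discSector γ) (fun z => ‖deriv f z‖ ^ 2) := by
  have hK := endpointConst_lt_top hα0 hρ1
  refine ⟨2 * (endpointConst α ρ).toReal + 1, by positivity, ?_⟩
  intro f Γ γ a b hA hf hn _ hγ hvol ha hb hcl
  have hoff : γ ⊆ offZeros f := by
    obtain ⟨x, -, rfl⟩ := hγ
    exact connectedComponentIn_subset _ _
  have hγcl : γ = closure γ \ {a, b} := by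
    have haγ : a ∉ γ := fun h => (hoff h).2 ha.2
    have hbγ : b ∉ γ := fun h => (hoff h).2 hb.2
    rw [hcl]
    ext y
    simp only [Set.mem_sdiff, mem_insert_iff, mem_singleton_iff]
    constructor
    · intro hy
      refine ⟨Or.inr (Or.inr hy), ?_⟩
      rintro (rfl | rfl)
      exacts [haγ hy, hbγ hy]
    · tauto
  have hm : MeasurableSet γ := by
    rw [hγcl]
    exact measurableSet_closure.diff (Set.toFinite _).measurableSet
  have hα : α ≤ 1 := by linarith
  have hTa := lintegral_endpoint_le (Γ := Γ) hα0 hα hρ1 hA.2 hf hn hγ hm hvol ha (by simp [hcl])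
  have hTb := lintegral_endpoint_le (Γ := Γ) hα0 hα hρ1 hA.2 hf hn hγ hm hvol hb (by simp [hcl])
  have hsub : sector1 a b γ ⊆ {z | z ∈ discSector γ ∧ ‖z - a‖ < 2 * (1 - ‖z‖)} ∪
      {z | z ∈ discSector γ ∧ ‖z - b‖ < 2 * (1 - ‖z‖)} := by
    rintro z ⟨hz, hd⟩
    exact (min_lt_iff.1 hd).imp (fun h => ⟨hz, h⟩) fun h => ⟨hz, h⟩
  have hC : 2 * endpointConst α ρ ≤ ENNReal.ofReal (2 * (endpointConst α ρ).toReal + 1) := by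
    rw [ENNReal.ofReal_add (by positivity) zero_le_one, ENNReal.ofReal_mul zero_le_two,
      ENNReal.ofReal_toReal hK.ne, ENNReal.ofReal_ofNat]
    exact le_self_add
  unfold nlint
  rw [mul_left_comm]
  refine mul_le_mul' le_rfl ?_
  calc _ ≤ _ := lintegral_mono_set hsub
    _ ≤ _ := lintegral_union_le _ _ _
    _ ≤ _ := add_le_add hTa hTb
    _ = 2 * endpointConst α ρ * _ := by rw [← two_mul, mul_assoc]
    _ ≤ _ := mul_le_mul' hC le_rfl
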